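/- Let k ≥ 1 and let n = kq + r with q ≥ 1 and 1 ≤ r ≤ k, and set j = 2^r + 2^{r+k} + 2^{r+2k} + ⋯ + 2^{n−k} (that is, j = ∑_{s=0}^{q−1} 2^{r+sk}). Then in A⟨k⟩ = F₂[ξ₁, …, ξ_k], the element ζ̄_n − ξ_r · ξ_k^{j} lies in 𝔪^{j+2}, where 𝔪 = (ξ₁, …, ξ_k) is the ideal generated by the variables. -/

import Mathlib

open MvPolynomial

/-- The dual Steenrod algebra `A = F₂[ξ₁, ξ₂, …]`; the variable `X i` represents `ξ_{i+1}`. -/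
noncomputable abbrev DualSteenrod : Type := MvPolynomial ℕ (ZMod 2)

/-- The conjugate classes, via Milnor's recursion
`ζ_n = ∑_{i=1}^{n} ξ_i^{2^{n−i}} ζ_{n−i}` (with `ζ_0 = 1`). -/
noncomputable def zeta : ℕ → DualSteenrod
  | 0 => 1
  | (n+1) => ∑ i ∈ Finset.range (n+1), (X i) ^ (2^(n-i)) * zeta (n-i)
  decreasing_by omega

/-- The projection `A → A⟨k⟩ = F₂[ξ₁, …, ξ_k]`, killing `ξ_i` for `i > k`.
In `MvPolynomial (Fin k) (ZMod 2)`, the variable `X i` represents `ξ_{i+1}`. -/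
noncomputable def proj (k : ℕ) :
    DualSteenrod →ₐ[ZMod 2] MvPolynomial (Fin k) (ZMod 2) :=
  aeval (fun i => if h : i < k then X (⟨i, h⟩ : Fin k) else 0)

/-- `ζ̄_n`, the image of `ζ_n` in `A⟨k⟩`. -/
noncomputable def zetaBar (k n : ℕ) : MvPolynomial (Fin k) (ZMod 2) :=
  proj k (zeta n)

theorem proj_X (k i : ℕ) :
    proj k (X i) = if h : i < k then X (⟨i, h⟩ : Fin k) else 0 := by
  simp [proj]

theorem zetaBar_zero (k : ℕ) : zetaBar k 0 = 1 := by
  simp [zetaBar, zeta]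

theorem zetaBar_succ (k n : ℕ) :
    zetaBar k (n + 1) =
      ∑ i ∈ Finset.range (n + 1), proj k (X i) ^ 2 ^ (n - i) * zetaBar k (n - i) := by
  simp [zetaBar, zeta]

/-- Modulo `𝔪 ^ N`, only one summand of Milnor's recursion survives if the powers of the variables
in all the other ones have exponent at least `N`. -/
theorem zetaBar_succ_sub_mem {k n i₀ N : ℕ} (hi₀ : i₀ ≤ n)
    (hN : ∀ i < k, i ≤ n → i ≠ i₀ → N ≤ 2 ^ (n - i)) :
    zetaBar k (n + 1) - proj k (X i₀) ^ 2 ^ (n - i₀) * zetaBar k (n - i₀) ∈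
      (Ideal.span (Set.range (X : Fin k → MvPolynomial (Fin k) (ZMod 2)))) ^ N := by
  rw [zetaBar_succ, ← Finset.add_sum_erase _ _ (Finset.mem_range_succ_iff.2 hi₀),
    add_sub_cancel_left]
  refine Ideal.sum_mem _ fun i hi => Ideal.mul_mem_right _ _ ?_
  rw [Finset.mem_erase, Finset.mem_range_succ_iff] at hi
  rw [proj_X]
  split_ifs with h
  · exact Ideal.pow_le_pow_right (hN i h hi.2 hi.1)
      (Ideal.pow_mem_pow (Ideal.subset_span (Set.mem_range_self _)) _)
  · simp

theorem sum_two_pow_add_two_le {k r : ℕ} (hk : 1 ≤ k) (hr : 1 ≤ r) (q : ℕ) :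
    ∑ s ∈ Finset.range (q + 1), 2 ^ (r + s * k) + 2 ≤ 2 ^ (r + q * k + 1) := by
  induction q with
  | zero =>
    have : 2 ^ 1 ≤ 2 ^ r := Nat.pow_le_pow_right two_pos hr
    simp [pow_succ]
    omega
  | succ q ih =>
    have : 2 ^ (r + q * k + 1) ≤ 2 ^ (r + (q + 1) * k) :=
      Nat.pow_le_pow_right two_pos (by rw [add_one_mul]; omega)
    rw [Finset.sum_range_succ, pow_succ 2 (r + (q + 1) * k)]
    omega

theorem zetaBar_sub_mem {k r : ℕ} (hr : 1 ≤ r) (hrk : r ≤ k) (q : ℕ) :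
    zetaBar k (k * q + r) - X (⟨r - 1, by omega⟩ : Fin k) *
        X (⟨k - 1, by omega⟩ : Fin k) ^ (∑ s ∈ Finset.range q, 2 ^ (r + s * k)) ∈
      (Ideal.span (Set.range (X : Fin k → MvPolynomial (Fin k) (ZMod 2)))) ^
        (∑ s ∈ Finset.range q, 2 ^ (r + s * k) + 2) := by
  induction q with
  | zero =>
    have h := zetaBar_succ_sub_mem (k := k) (n := r - 1) (N := 2) le_rfl fun i _ hi hne =>
      Nat.pow_le_pow_right two_pos (show 1 ≤ r - 1 - i by omega)
    rw [Nat.sub_add_cancel hr, Nat.sub_self, zetaBar_zero, proj_X,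
      dif_pos (show r - 1 < k by omega)] at h
    simpa using h
  | succ q ih =>
    have hk : 1 ≤ k := hr.trans hrk
    have h := zetaBar_succ_sub_mem (k := k) (n := k * (q + 1) + r - 1) (i₀ := k - 1)
      (N := ∑ s ∈ Finset.range (q + 1), 2 ^ (r + s * k) + 2)
      (by rw [mul_add_one]; omega) fun i hik _ hne =>
        (sum_two_pow_add_two_le hk hr q).trans
          (Nat.pow_le_pow_right two_pos (by rw [mul_add_one, mul_comm q k]; omega))
    rw [Nat.sub_add_cancel (by omega), proj_X, dif_pos (show k - 1 < k by omega),
      show k * (q + 1) + r - 1 - (k - 1) = k * q + r by rw [mul_add_one]; omega] at h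
    have h' := Ideal.mul_mem_mul (Ideal.pow_mem_pow (Ideal.subset_span
      (Set.mem_range_self (f := (X : Fin k → MvPolynomial (Fin k) (ZMod 2)))
        ⟨k - 1, by omega⟩)) (2 ^ (k * q + r))) ih
    have he : ∑ s ∈ Finset.range (q + 1), 2 ^ (r + s * k) =
        2 ^ (k * q + r) + ∑ s ∈ Finset.range q, 2 ^ (r + s * k) := by
      rw [Finset.sum_range_succ, add_comm, mul_comm k q, add_comm r]
    rw [← pow_add, ← add_assoc, ← he] at h'
    convert add_mem h h' using 1
    rw [he, pow_add]
    ring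

/-- STATEMENT 12: For `n = kq + r` with `q ≥ 1` and `1 ≤ r ≤ k`, and
`j = 2^r + 2^{r+k} + ⋯ + 2^{n−k}`, in `A⟨k⟩` the element `ζ̄_n − ξ_r·ξ_k^j`
lies in `𝔪^{j+2}`, where `𝔪 = (ξ₁, …, ξ_k)`.  (The variable `X ⟨i-1⟩`
represents `ξ_i`.) -/
theorem zetaBar_leading_term (k q r : ℕ) (hq : 1 ≤ q) (hr1 : 1 ≤ r) (hrk : r ≤ k)
    (n : ℕ) (hn : n = k * q + r)
    (j : ℕ) (hj : j = ∑ s ∈ Finset.range q, 2 ^ (r + s * k)) :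
    zetaBar k n -
        X (⟨r - 1, by omega⟩ : Fin k) * X (⟨k - 1, by omega⟩ : Fin k) ^ j ∈
      (Ideal.span (Set.range (X : Fin k → MvPolynomial (Fin k) (ZMod 2)))) ^ (j + 2) := by
  subst hn hj
  exact zetaBar_sub_mem hr1 hrk q
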